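/- With the notation of the context: every matrix η(V) is invertible; the map θ: GL(d*) → GL(a+b,k) is an injective group homomorphism whose image is contained in the parabolic subgroup P(d*); and η is equivariant with respect to θ, i.e., for every V ∈ rep_{Q*(n)}(d*) and g ∈ GL(d*) there exists κ ∈ K such that η(V·g) = κ·η(V)·θ(g). -/

import Mathlib

open Matrix

/-! Statement 12: the embedding `η : rep_{Q*(n)}(d*) → S(d*) ⊆ K\GL(a+b)` and the group
embedding `θ : GL(d*) → P(d*) ≤ GL(a+b)`.

Dimension data: `dx i = d*(x_i)` for `0 ≤ i ≤ n`, `dy0 = d*(y₀)`, `dy0' = d*(y₀')`,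
`dy i = d*(y_{i+1})` for `0 ≤ i ≤ n-1`. -/

/-- Partial sums `psum f m = f 0 + ⋯ + f (m-1)`. -/
def psum (f : ℕ → ℕ) (m : ℕ) : ℕ := ∑ i ∈ Finset.range m, f i

/-- `d*_x`, the total dimension over the `x`-vertices. -/
def dXt (dx : ℕ → ℕ) (n : ℕ) : ℕ := psum dx (n + 1)

/-- `d*_y`, the total dimension over the vertices `y₁, …, y_n`. -/
def dYt (dy : ℕ → ℕ) (n : ℕ) : ℕ := psum dy n

/-- `a = d*(y₀) + d*_y + d*_x`. -/
def aD (n : ℕ) (dx dy : ℕ → ℕ) (dy0 : ℕ) : ℕ := dy0 + dYt dy n + dXt dx n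

/-- `a + b`. -/
def NN (n : ℕ) (dx dy : ℕ → ℕ) (dy0 dy0' : ℕ) : ℕ :=
  aD n dx dy dy0 + (dy0' + dYt dy n + dXt dx n)

abbrev inBlk (off len i : ℕ) : Prop := off ≤ i ∧ i < off + len

abbrev Jpos (roff coff len i j : ℕ) : Prop :=
  inBlk roff len i ∧ inBlk coff len j ∧ (i - roff) + (j - coff) = len - 1

abbrev Ipos (roff coff len i j : ℕ) : Prop :=
  inBlk roff len i ∧ inBlk coff len j ∧ i - roff = j - coff

/-- A representation of the quiver `Q*(n)`: `vb0 = V_{β₀}`, `va1 = V_{α₁}`,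
`va1' = V_{α₁'}`, `vb i = V_{β_{i+1}}` (for `0 ≤ i ≤ n-1`) and `va i = V_{α_{i+2}}`
(for `0 ≤ i ≤ n-2`). -/
structure QRep (k : Type) [Field k] (n : ℕ) (dx dy : ℕ → ℕ) (dy0 dy0' : ℕ) where
  vb0 : Matrix (Fin dy0) (Fin (dx 0)) k
  va1 : Matrix (Fin dy0) (Fin (dx 1)) k
  va1' : Matrix (Fin dy0') (Fin (dx 1)) k
  vb : ∀ i : Fin n, Matrix (Fin (dy (i : ℕ))) (Fin (dx ((i : ℕ) + 1))) k
  va : ∀ i : Fin (n - 1), Matrix (Fin (dy (i : ℕ))) (Fin (dx ((i : ℕ) + 2))) k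

/-- The entry of the zig-zag matrix `A_V` (block rows `y₀, y₁, …, y_n`, block columns
`x₀, …, x_n`; nonzero blocks `(y₀,x₀) = V_{β₀}`, `(y_{i−1},x_i) = V_{α_i}`,
`(y_i,x_i) = V_{β_i}`) at the global position `(p, c)`. -/
def Aent {k : Type} [Field k] {n : ℕ} {dx dy : ℕ → ℕ} {dy0 dy0' : ℕ}
    (V : QRep k n dx dy dy0 dy0') (p c : ℕ) : k :=
  (if h : p < dy0 ∧ c < dx 0 then V.vb0 ⟨p, h.1⟩ ⟨c, h.2⟩ else 0) +
  (if h : p < dy0 ∧ psum dx 1 ≤ c ∧ c < psum dx 2 then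
      V.va1 ⟨p, h.1⟩ ⟨c - psum dx 1, by
        have hs : psum dx 2 = psum dx 1 + dx 1 := Finset.sum_range_succ dx 1
        omega⟩
    else 0) +
  (∑ i : Fin n,
    if h : dy0 + psum dy (i : ℕ) ≤ p ∧ p < dy0 + psum dy ((i : ℕ) + 1) ∧
        psum dx ((i : ℕ) + 1) ≤ c ∧ c < psum dx ((i : ℕ) + 2) then
      V.vb i
        ⟨p - (dy0 + psum dy (i : ℕ)), by
          have hs : psum dy ((i : ℕ) + 1) = psum dy (i : ℕ) + dy (i : ℕ) :=
            Finset.sum_range_succ dy (i : ℕ)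
          omega⟩
        ⟨c - psum dx ((i : ℕ) + 1), by
          have hs : psum dx ((i : ℕ) + 2) = psum dx ((i : ℕ) + 1) + dx ((i : ℕ) + 1) :=
            Finset.sum_range_succ dx ((i : ℕ) + 1)
          omega⟩
    else 0) +
  (∑ i : Fin (n - 1),
    if h : dy0 + psum dy (i : ℕ) ≤ p ∧ p < dy0 + psum dy ((i : ℕ) + 1) ∧
        psum dx ((i : ℕ) + 2) ≤ c ∧ c < psum dx ((i : ℕ) + 3) then
      V.va i
        ⟨p - (dy0 + psum dy (i : ℕ)), by
          have hs : psum dy ((i : ℕ) + 1) = psum dy (i : ℕ) + dy (i : ℕ) :=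
            Finset.sum_range_succ dy (i : ℕ)
          omega⟩
        ⟨c - psum dx ((i : ℕ) + 2), by
          have hs : psum dx ((i : ℕ) + 3) = psum dx ((i : ℕ) + 2) + dx ((i : ℕ) + 2) :=
            Finset.sum_range_succ dx ((i : ℕ) + 2)
          omega⟩
    else 0)

/-- The entry of `B'_V = [0 B_V]` (block rows `y₀', y₁, …, y_n`, block columns
`x₀, x₁, …, x_n` with the `x₀` column block zero; nonzero blocks `(y₀',x₁) = V_{α₁'}`,
`(y_{i−1},x_i) = V_{α_i}` for `i ≥ 2`, `(y_i,x_i) = V_{β_i}`) at `(p, c)`. -/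
def Bent {k : Type} [Field k] {n : ℕ} {dx dy : ℕ → ℕ} {dy0 dy0' : ℕ}
    (V : QRep k n dx dy dy0 dy0') (p c : ℕ) : k :=
  (if h : p < dy0' ∧ psum dx 1 ≤ c ∧ c < psum dx 2 then
      V.va1' ⟨p, h.1⟩ ⟨c - psum dx 1, by
        have hs : psum dx 2 = psum dx 1 + dx 1 := Finset.sum_range_succ dx 1
        omega⟩
    else 0) +
  (∑ i : Fin n,
    if h : dy0' + psum dy (i : ℕ) ≤ p ∧ p < dy0' + psum dy ((i : ℕ) + 1) ∧
        psum dx ((i : ℕ) + 1) ≤ c ∧ c < psum dx ((i : ℕ) + 2) then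
      V.vb i
        ⟨p - (dy0' + psum dy (i : ℕ)), by
          have hs : psum dy ((i : ℕ) + 1) = psum dy (i : ℕ) + dy (i : ℕ) :=
            Finset.sum_range_succ dy (i : ℕ)
          omega⟩
        ⟨c - psum dx ((i : ℕ) + 1), by
          have hs : psum dx ((i : ℕ) + 2) = psum dx ((i : ℕ) + 1) + dx ((i : ℕ) + 1) :=
            Finset.sum_range_succ dx ((i : ℕ) + 1)
          omega⟩
    else 0) +
  (∑ i : Fin (n - 1),
    if h : dy0' + psum dy (i : ℕ) ≤ p ∧ p < dy0' + psum dy ((i : ℕ) + 1) ∧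
        psum dx ((i : ℕ) + 2) ≤ c ∧ c < psum dx ((i : ℕ) + 3) then
      V.va i
        ⟨p - (dy0' + psum dy (i : ℕ)), by
          have hs : psum dy ((i : ℕ) + 1) = psum dy (i : ℕ) + dy (i : ℕ) :=
            Finset.sum_range_succ dy (i : ℕ)
          omega⟩
        ⟨c - psum dx ((i : ℕ) + 2), by
          have hs : psum dx ((i : ℕ) + 3) = psum dx ((i : ℕ) + 2) + dx ((i : ℕ) + 2) :=
            Finset.sum_range_succ dx ((i : ℕ) + 2)
          omega⟩
    else 0)

/-- The matrix `η(V)`: block row sizes `(d*(y₀), d*_y, d*_x, d*(y₀'), d*_y, d*_x)`,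
block column sizes `(d*_x, d*_x, d*_y, d*(y₀), d*(y₀'), d*_y)`; block rows 1–2 of block
column 2 form `A_V`, block rows 4–5 of block column 2 form `B'_V`, and the other nonzero
blocks are `(1,4)=J`, `(2,3)=J`, `(3,1)=J`, `(4,5)=1`, `(5,3)=J`, `(5,6)=1`, `(6,1)=J`,
`(6,2)=1`. -/
def etaMat {k : Type} [Field k] {n : ℕ} {dx dy : ℕ → ℕ} {dy0 dy0' : ℕ}
    (V : QRep k n dx dy dy0 dy0') :
    Matrix (Fin (NN n dx dy dy0 dy0')) (Fin (NN n dx dy dy0 dy0')) k :=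
  Matrix.of fun i c =>
    if (i : ℕ) < dy0 + dYt dy n ∧ dXt dx n ≤ (c : ℕ) ∧ (c : ℕ) < 2 * dXt dx n then
      Aent V (i : ℕ) ((c : ℕ) - dXt dx n)
    else if aD n dx dy dy0 ≤ (i : ℕ) ∧ (i : ℕ) < aD n dx dy dy0 + dy0' + dYt dy n ∧
        dXt dx n ≤ (c : ℕ) ∧ (c : ℕ) < 2 * dXt dx n then
      Bent V ((i : ℕ) - aD n dx dy dy0) ((c : ℕ) - dXt dx n)
    else if
      Jpos 0 (2 * dXt dx n + dYt dy n) dy0 (i : ℕ) (c : ℕ) ∨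
      Jpos dy0 (2 * dXt dx n) (dYt dy n) (i : ℕ) (c : ℕ) ∨
      Jpos (dy0 + dYt dy n) 0 (dXt dx n) (i : ℕ) (c : ℕ) ∨
      Ipos (aD n dx dy dy0) (2 * dXt dx n + dYt dy n + dy0) dy0' (i : ℕ) (c : ℕ) ∨
      Jpos (aD n dx dy dy0 + dy0') (2 * dXt dx n) (dYt dy n) (i : ℕ) (c : ℕ) ∨
      Ipos (aD n dx dy dy0 + dy0') (2 * dXt dx n + dYt dy n + dy0 + dy0') (dYt dy n)
        (i : ℕ) (c : ℕ) ∨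
      Jpos (aD n dx dy dy0 + dy0' + dYt dy n) 0 (dXt dx n) (i : ℕ) (c : ℕ) ∨
      Ipos (aD n dx dy dy0 + dy0' + dYt dy n) (dXt dx n) (dXt dx n) (i : ℕ) (c : ℕ)
    then 1 else 0

/-- The group `GL(d*)`. -/
def GLd (k : Type) [Field k] (n : ℕ) (dx dy : ℕ → ℕ) (dy0 dy0' : ℕ) : Type :=
  (Matrix (Fin dy0) (Fin dy0) k)ˣ × (Matrix (Fin dy0') (Fin dy0') k)ˣ ×
  (∀ j : Fin (n + 1), (Matrix (Fin (dx (j : ℕ))) (Fin (dx (j : ℕ))) k)ˣ) ×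
  (∀ j : Fin n, (Matrix (Fin (dy (j : ℕ))) (Fin (dy (j : ℕ))) k)ˣ)

instance (k : Type) [Field k] (n : ℕ) (dx dy : ℕ → ℕ) (dy0 dy0' : ℕ) :
    Group (GLd k n dx dy dy0 dy0') :=
  inferInstanceAs (Group ((Matrix (Fin dy0) (Fin dy0) k)ˣ × (Matrix (Fin dy0') (Fin dy0') k)ˣ ×
    (∀ j : Fin (n + 1), (Matrix (Fin (dx (j : ℕ))) (Fin (dx (j : ℕ))) k)ˣ) ×
    (∀ j : Fin n, (Matrix (Fin (dy (j : ℕ))) (Fin (dy (j : ℕ))) k)ˣ)))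

/-- The entry at `(p, c)` of the block diagonal matrix `g_x = blockdiag(g_{x₀},…,g_{x_n})`. -/
def gxEnt {k : Type} [Field k] {n : ℕ} {dx : ℕ → ℕ}
    (g : ∀ j : Fin (n + 1), (Matrix (Fin (dx (j : ℕ))) (Fin (dx (j : ℕ))) k)ˣ)
    (p c : ℕ) : k :=
  ∑ j : Fin (n + 1),
    if h : psum dx (j : ℕ) ≤ p ∧ p < psum dx ((j : ℕ) + 1) ∧
        psum dx (j : ℕ) ≤ c ∧ c < psum dx ((j : ℕ) + 1) then
      ((g j : (Matrix (Fin (dx (j : ℕ))) (Fin (dx (j : ℕ))) k)ˣ) :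
          Matrix (Fin (dx (j : ℕ))) (Fin (dx (j : ℕ))) k)
        ⟨p - psum dx (j : ℕ), by
          have hs : psum dx ((j : ℕ) + 1) = psum dx (j : ℕ) + dx (j : ℕ) :=
            Finset.sum_range_succ dx (j : ℕ)
          omega⟩
        ⟨c - psum dx (j : ℕ), by
          have hs : psum dx ((j : ℕ) + 1) = psum dx (j : ℕ) + dx (j : ℕ) :=
            Finset.sum_range_succ dx (j : ℕ)
          omega⟩
    else 0

/-- The entry at `(p, c)` of the block diagonal matrix `g_y = blockdiag(g_{y₁},…,g_{y_n})`. -/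
def gyEnt {k : Type} [Field k] {n : ℕ} {dy : ℕ → ℕ}
    (g : ∀ j : Fin n, (Matrix (Fin (dy (j : ℕ))) (Fin (dy (j : ℕ))) k)ˣ)
    (p c : ℕ) : k :=
  ∑ j : Fin n,
    if h : psum dy (j : ℕ) ≤ p ∧ p < psum dy ((j : ℕ) + 1) ∧
        psum dy (j : ℕ) ≤ c ∧ c < psum dy ((j : ℕ) + 1) then
      ((g j : (Matrix (Fin (dy (j : ℕ))) (Fin (dy (j : ℕ))) k)ˣ) :
          Matrix (Fin (dy (j : ℕ))) (Fin (dy (j : ℕ))) k)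
        ⟨p - psum dy (j : ℕ), by
          have hs : psum dy ((j : ℕ) + 1) = psum dy (j : ℕ) + dy (j : ℕ) :=
            Finset.sum_range_succ dy (j : ℕ)
          omega⟩
        ⟨c - psum dy (j : ℕ), by
          have hs : psum dy ((j : ℕ) + 1) = psum dy (j : ℕ) + dy (j : ℕ) :=
            Finset.sum_range_succ dy (j : ℕ)
          omega⟩
    else 0

/-- The matrix `θ(g) = blockdiag(J g_x J, g_x, J g_y J, J g_{y₀} J, g_{y₀'}, g_y)`, with
block sizes `(d*_x, d*_x, d*_y, d*(y₀), d*(y₀'), d*_y)` (here `J M J` is the 180°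
rotation of `M`). -/
def thetaMat {k : Type} [Field k] {n : ℕ} {dx dy : ℕ → ℕ} {dy0 dy0' : ℕ}
    (g : GLd k n dx dy dy0 dy0') :
    Matrix (Fin (NN n dx dy dy0 dy0')) (Fin (NN n dx dy dy0 dy0')) k :=
  Matrix.of fun i c =>
    if (i : ℕ) < dXt dx n ∧ (c : ℕ) < dXt dx n then
      gxEnt g.2.2.1 (dXt dx n - 1 - (i : ℕ)) (dXt dx n - 1 - (c : ℕ))
    else if dXt dx n ≤ (i : ℕ) ∧ (i : ℕ) < 2 * dXt dx n ∧
        dXt dx n ≤ (c : ℕ) ∧ (c : ℕ) < 2 * dXt dx n then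
      gxEnt g.2.2.1 ((i : ℕ) - dXt dx n) ((c : ℕ) - dXt dx n)
    else if 2 * dXt dx n ≤ (i : ℕ) ∧ (i : ℕ) < 2 * dXt dx n + dYt dy n ∧
        2 * dXt dx n ≤ (c : ℕ) ∧ (c : ℕ) < 2 * dXt dx n + dYt dy n then
      gyEnt g.2.2.2 (dYt dy n - 1 - ((i : ℕ) - 2 * dXt dx n))
        (dYt dy n - 1 - ((c : ℕ) - 2 * dXt dx n))
    else if h : 2 * dXt dx n + dYt dy n ≤ (i : ℕ) ∧
        (i : ℕ) < 2 * dXt dx n + dYt dy n + dy0 ∧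
        2 * dXt dx n + dYt dy n ≤ (c : ℕ) ∧ (c : ℕ) < 2 * dXt dx n + dYt dy n + dy0 then
      ((g.1 : (Matrix (Fin dy0) (Fin dy0) k)ˣ) : Matrix (Fin dy0) (Fin dy0) k)
        ⟨dy0 - 1 - ((i : ℕ) - (2 * dXt dx n + dYt dy n)), by omega⟩
        ⟨dy0 - 1 - ((c : ℕ) - (2 * dXt dx n + dYt dy n)), by omega⟩
    else if h : 2 * dXt dx n + dYt dy n + dy0 ≤ (i : ℕ) ∧
        (i : ℕ) < 2 * dXt dx n + dYt dy n + dy0 + dy0' ∧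
        2 * dXt dx n + dYt dy n + dy0 ≤ (c : ℕ) ∧
        (c : ℕ) < 2 * dXt dx n + dYt dy n + dy0 + dy0' then
      ((g.2.1 : (Matrix (Fin dy0') (Fin dy0') k)ˣ) : Matrix (Fin dy0') (Fin dy0') k)
        ⟨(i : ℕ) - (2 * dXt dx n + dYt dy n + dy0), by omega⟩
        ⟨(c : ℕ) - (2 * dXt dx n + dYt dy n + dy0), by omega⟩
    else if 2 * dXt dx n + dYt dy n + dy0 + dy0' ≤ (i : ℕ) ∧
        2 * dXt dx n + dYt dy n + dy0 + dy0' ≤ (c : ℕ) then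
      gyEnt g.2.2.2 ((i : ℕ) - (2 * dXt dx n + dYt dy n + dy0 + dy0'))
        ((c : ℕ) - (2 * dXt dx n + dYt dy n + dy0 + dy0'))
    else 0

/-- The subgroup `K = diag(GL(a), GL(b)) ≤ GL(a+b)` as a set of matrices. -/
def kDiag (k : Type) [Field k] (n : ℕ) (dx dy : ℕ → ℕ) (dy0 dy0' : ℕ) :
    Set (Matrix (Fin (NN n dx dy dy0 dy0')) (Fin (NN n dx dy dy0 dy0')) k) :=
  {g | IsUnit g ∧ ∀ i c : Fin (NN n dx dy dy0 dy0'),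
    (((i : ℕ) < aD n dx dy dy0 ∧ aD n dx dy dy0 ≤ (c : ℕ)) ∨
      (aD n dx dy dy0 ≤ (i : ℕ) ∧ (c : ℕ) < aD n dx dy dy0)) → g i c = 0}

/-- `x` is a boundary of the column partition of `a + b` into consecutive blocks of
sizes `d*(x_n), …, d*(x₀), d*(x₀), …, d*(x_n), d*(y_n), …, d*(y₁), d*(y₀)+d*(y₀'),
d*(y₁), …, d*(y_n)`. -/
def isCut (n : ℕ) (dx dy : ℕ → ℕ) (dy0 dy0' : ℕ) (x : ℕ) : Prop :=
  (∃ m ≤ n + 1, x = dXt dx n - psum dx m) ∨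
  (∃ m ≤ n + 1, x = dXt dx n + psum dx m) ∨
  (∃ m ≤ n, x = 2 * dXt dx n + dYt dy n - psum dy m) ∨
  x = 2 * dXt dx n + dYt dy n + dy0 + dy0' ∨
  (∃ m ≤ n, x = 2 * dXt dx n + dYt dy n + dy0 + dy0' + psum dy m)

/-- The parabolic subgroup `P(d*)` of block upper triangular invertible matrices for the
above partition. -/
def pPara (k : Type) [Field k] (n : ℕ) (dx dy : ℕ → ℕ) (dy0 dy0' : ℕ) :
    Set (Matrix (Fin (NN n dx dy dy0 dy0')) (Fin (NN n dx dy dy0 dy0')) k) :=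
  {g | IsUnit g ∧ ∀ i c : Fin (NN n dx dy dy0 dy0'),
    (∃ x : ℕ, isCut n dx dy dy0 dy0' x ∧ (c : ℕ) < x ∧ x ≤ (i : ℕ)) → g i c = 0}

/-- The right action of `GL(d*)` on `rep_{Q*(n)}(d*)`: `(V·g)_a = g_{ta}⁻¹ V_a g_{ha}`. -/
def repAct {k : Type} [Field k] {n : ℕ} {dx dy : ℕ → ℕ} {dy0 dy0' : ℕ} (hn : 1 ≤ n)
    (V : QRep k n dx dy dy0 dy0') (g : GLd k n dx dy dy0 dy0') :
    QRep k n dx dy dy0 dy0' where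
  vb0 := ((g.1⁻¹ : (Matrix (Fin dy0) (Fin dy0) k)ˣ) : Matrix (Fin dy0) (Fin dy0) k) *
    V.vb0 * (↑(g.2.2.1 ⟨0, Nat.succ_pos n⟩) : Matrix (Fin (dx 0)) (Fin (dx 0)) k)
  va1 := ((g.1⁻¹ : (Matrix (Fin dy0) (Fin dy0) k)ˣ) : Matrix (Fin dy0) (Fin dy0) k) *
    V.va1 * (↑(g.2.2.1 ⟨1, by omega⟩) : Matrix (Fin (dx 1)) (Fin (dx 1)) k)
  va1' := ((g.2.1⁻¹ : (Matrix (Fin dy0') (Fin dy0') k)ˣ) : Matrix (Fin dy0') (Fin dy0') k) *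
    V.va1' * (↑(g.2.2.1 ⟨1, by omega⟩) : Matrix (Fin (dx 1)) (Fin (dx 1)) k)
  vb := fun i =>
    (((g.2.2.2 i)⁻¹ : (Matrix (Fin (dy (i : ℕ))) (Fin (dy (i : ℕ))) k)ˣ) :
        Matrix (Fin (dy (i : ℕ))) (Fin (dy (i : ℕ))) k) *
      V.vb i * (↑(g.2.2.1 ⟨(i : ℕ) + 1, Nat.succ_lt_succ i.isLt⟩) : Matrix (Fin (dx ((i : ℕ) + 1))) (Fin (dx ((i : ℕ) + 1))) k)
  va := fun i =>
    (((g.2.2.2 ⟨(i : ℕ), by have := i.isLt; omega⟩)⁻¹ :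
        (Matrix (Fin (dy (i : ℕ))) (Fin (dy (i : ℕ))) k)ˣ) :
        Matrix (Fin (dy (i : ℕ))) (Fin (dy (i : ℕ))) k) *
      V.va i * (↑(g.2.2.1 ⟨(i : ℕ) + 2, by have := i.isLt; omega⟩) : Matrix (Fin (dx ((i : ℕ) + 2))) (Fin (dx ((i : ℕ) + 2))) k)

/-- Row-selection matrix: the rows `off, …, off+len-1` of the identity. -/
def iota (k : Type) [Field k] (off len N : ℕ) : Matrix (Fin len) (Fin N) k :=
  Matrix.of fun r p => if off + (r : ℕ) = (p : ℕ) then 1 else 0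

theorem psum_succ' (f : ℕ → ℕ) (m : ℕ) : psum f (m + 1) = psum f m + f m :=
  Finset.sum_range_succ f m

theorem psum_mono' (f : ℕ → ℕ) {i j : ℕ} (h : i ≤ j) : psum f i ≤ psum f j := by
  induction h with
  | refl => exact le_rfl
  | step _ ih => exact ih.trans (by rw [psum_succ']; omega)

theorem psum_exists (f : ℕ → ℕ) (m p : ℕ) (h : p < psum f m) :
    ∃ j, j < m ∧ psum f j ≤ p ∧ p < psum f (j + 1) := by
  induction m with
  | zero => simp [psum] at h
  | succ m ih =>
    by_cases h' : p < psum f m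
    · obtain ⟨j, hj, h1⟩ := ih h'
      exact ⟨j, by omega, h1⟩
    · exact ⟨m, by omega, by omega, h⟩

section iotaLemmas
variable {k : Type} [Field k]

theorem iota_T_mul_apply {len N l : ℕ} (off : ℕ) (M : Matrix (Fin len) (Fin l) k)
    (p : Fin N) (c : Fin l) :
    ((iota k off len N)ᵀ * M) p c =
      if h : off ≤ (p : ℕ) ∧ (p : ℕ) < off + len then M ⟨(p : ℕ) - off, by omega⟩ c else 0 := by
  rw [Matrix.mul_apply]
  split_ifs with h
  · rw [Finset.sum_eq_single (⟨(p : ℕ) - off, by omega⟩ : Fin len)]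
    · simp [iota, h.1]
    · intro b _ hb
      have : off + (b : ℕ) ≠ p := fun h' => hb (Fin.ext (by simp; omega))
      simp [iota, this]
    · simp
  · apply Finset.sum_eq_zero
    intro b _
    have : off + (b : ℕ) ≠ p := fun h' => h (by omega)
    simp [iota, this]

theorem mul_iota_apply {len N l : ℕ} (off : ℕ) (M : Matrix (Fin l) (Fin len) k)
    (p : Fin N) (c : Fin l) :
    (M * (iota k off len N)) c p =
      if h : off ≤ (p : ℕ) ∧ (p : ℕ) < off + len then M c ⟨(p : ℕ) - off, by omega⟩ else 0 := by
  have := iota_T_mul_apply off Mᵀ p c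
  rw [← Matrix.transpose_mul, Matrix.transpose_apply] at this
  simpa using this

theorem dent {l l' N N' : ℕ} (off coff u u' : ℕ) (hu : u = off + l) (hu' : u' = coff + l')
    (M : Matrix (Fin l) (Fin l') k) (p : Fin N) (c : Fin N')
    (h1 : ∀ _ : off ≤ (p : ℕ) ∧ (p : ℕ) < u ∧ coff ≤ (c : ℕ) ∧ (c : ℕ) < u', (p : ℕ) - off < l)
    (h2 : ∀ _ : off ≤ (p : ℕ) ∧ (p : ℕ) < u ∧ coff ≤ (c : ℕ) ∧ (c : ℕ) < u', (c : ℕ) - coff < l') :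
    (if h : off ≤ (p : ℕ) ∧ (p : ℕ) < u ∧ coff ≤ (c : ℕ) ∧ (c : ℕ) < u' then
      M ⟨(p : ℕ) - off, h1 h⟩ ⟨(c : ℕ) - coff, h2 h⟩ else 0) =
    ((iota k off l N)ᵀ * M * iota k coff l' N') p c := by
  subst hu hu'
  rw [mul_iota_apply]
  split_ifs with h h' h'
  · rw [iota_T_mul_apply, dif_pos ⟨h.1, h.2.1⟩]
  · omega
  · rw [iota_T_mul_apply, dif_neg (by omega)]
  · rfl

theorem iota_mul_T_self {off len N : ℕ} (h : off + len ≤ N) :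
    iota k off len N * (iota k off len N)ᵀ = 1 := by
  ext r s
  rw [← Matrix.transpose_apply (_ * _), Matrix.transpose_mul, Matrix.transpose_transpose,
    Matrix.mul_apply, Finset.sum_eq_single (⟨off + r, by omega⟩ : Fin N)]
  · by_cases hrs : r = s
    · subst hrs
      simp [iota]
    · have : (s : ℕ) ≠ r := fun h => hrs (Fin.ext h.symm)
      simp [iota, hrs, this]
  · intro b _ hb
    have : off + (r : ℕ) ≠ b := fun h' => hb (Fin.ext (by simp [h']))
    simp [iota, this]
  · simp

theorem iota_mul_T_ne {off len off' len' N : ℕ} (h : off + len ≤ off' ∨ off' + len' ≤ off) :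
    iota k off len N * (iota k off' len' N)ᵀ = 0 := by
  ext r s
  rw [Matrix.mul_apply]
  apply Finset.sum_eq_zero
  intro p _
  by_cases h1 : off + (r : ℕ) = p
  · have : off' + (s : ℕ) ≠ p := by omega
    simp [iota, this]
  · simp [iota, h1]

/-- Block diagonal matrix assembled with selection matrices. -/
def gmat {m : ℕ} {d : ℕ → ℕ} (N : ℕ)
    (g : ∀ j : Fin m, Matrix (Fin (d (j : ℕ))) (Fin (d (j : ℕ))) k) : Matrix (Fin N) (Fin N) k :=
  ∑ j : Fin m, (iota k (psum d j) (d j) N)ᵀ * g j * iota k (psum d j) (d j) N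

theorem iota_orth {m : ℕ} {d : ℕ → ℕ} {N : ℕ} (i j : Fin m) (h : i ≠ j) :
    iota k (psum d i) (d i) N * (iota k (psum d j) (d j) N)ᵀ = 0 := by
  apply iota_mul_T_ne
  have h' : (i : ℕ) ≠ j := fun h' => h (Fin.ext h')
  rcases Nat.lt_or_gt_of_ne h' with h' | h'
  · left; rw [← psum_succ']; exact psum_mono' d h'
  · right; rw [← psum_succ']; exact psum_mono' d h'

theorem iota_self {m : ℕ} {d : ℕ → ℕ} {N : ℕ} (hN : psum d m ≤ N) (j : Fin m) :
    iota k (psum d j) (d j) N * (iota k (psum d j) (d j) N)ᵀ = 1 := by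
  apply iota_mul_T_self
  rw [← psum_succ']
  exact (psum_mono' d j.2).trans hN

theorem iota_gmat {m : ℕ} {d : ℕ → ℕ} {N : ℕ} (hN : psum d m ≤ N)
    (g : ∀ j : Fin m, Matrix (Fin (d (j : ℕ))) (Fin (d (j : ℕ))) k) (j : Fin m) :
    iota k (psum d j) (d j) N * gmat N g = g j * iota k (psum d j) (d j) N := by
  rw [gmat, Matrix.mul_sum, Finset.sum_eq_single j]
  · rw [← Matrix.mul_assoc, ← Matrix.mul_assoc, iota_self hN, Matrix.one_mul]
  · intro i _ hi
    rw [← Matrix.mul_assoc, ← Matrix.mul_assoc, iota_orth j i (Ne.symm hi), Matrix.zero_mul,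
      Matrix.zero_mul]
  · simp

theorem gmat_iotaT {m : ℕ} {d : ℕ → ℕ} {N : ℕ} (hN : psum d m ≤ N)
    (g : ∀ j : Fin m, Matrix (Fin (d (j : ℕ))) (Fin (d (j : ℕ))) k) (j : Fin m) :
    gmat N g * (iota k (psum d j) (d j) N)ᵀ = (iota k (psum d j) (d j) N)ᵀ * g j := by
  rw [gmat, Matrix.sum_mul, Finset.sum_eq_single j]
  · rw [Matrix.mul_assoc, iota_self hN, Matrix.mul_one]
  · intro i _ hi
    rw [Matrix.mul_assoc, iota_orth i j hi, Matrix.mul_zero]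
  · simp

theorem gmat_mul {m : ℕ} {d : ℕ → ℕ} {N : ℕ} (hN : psum d m ≤ N)
    (g g' : ∀ j : Fin m, Matrix (Fin (d (j : ℕ))) (Fin (d (j : ℕ))) k) :
    gmat N (fun j => g j * g' j) = gmat N g * gmat N g' := by
  conv_rhs => rw [gmat, Matrix.sum_mul]
  rw [gmat]
  apply Finset.sum_congr rfl
  intro j _
  rw [Matrix.mul_assoc _ _ (gmat N g'), iota_gmat hN]
  simp only [Matrix.mul_assoc]

theorem gmat_one {m : ℕ} {d : ℕ → ℕ} {N : ℕ} (hN : psum d m = N) :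
    gmat (k := k) N (fun j : Fin m => (1 : Matrix (Fin (d (j : ℕ))) (Fin (d (j : ℕ))) k)) = 1 := by
  ext p c
  obtain ⟨j, hj, h1, h2⟩ := psum_exists d m p (by omega)
  rw [psum_succ'] at h2
  rw [gmat, Matrix.sum_apply, Finset.sum_eq_single (⟨j, hj⟩ : Fin m)]
  · rw [Matrix.mul_one, iota_T_mul_apply, dif_pos ⟨h1, h2⟩]
    by_cases hpc : p = c
    · subst hpc
      simp [iota, h1]
    · have : (p : ℕ) ≠ c := fun h => hpc (Fin.ext h)
      simp [iota, h1, hpc, this]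
  · intro b _ hb
    rw [Matrix.mul_one, iota_T_mul_apply, dif_neg]
    rintro ⟨h3, h4⟩
    rw [← psum_succ'] at h2 h4
    apply hb
    apply Fin.ext
    by_contra h
    rcases Nat.lt_or_gt_of_ne h with h | h
    · have := psum_mono' d (Nat.succ_le_of_lt h)
      simp at this
      omega
    · have := psum_mono' d (Nat.succ_le_of_lt h)
      simp at this
      omega
  · simp

theorem gmat_inj {m : ℕ} {d : ℕ → ℕ} {N : ℕ} (hN : psum d m ≤ N)
    (g g' : ∀ j : Fin m, Matrix (Fin (d (j : ℕ))) (Fin (d (j : ℕ))) k)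
    (h : gmat N g = gmat N g') : g = g' := by
  funext j
  have h1 := congrArg (fun M => iota k (psum d j) (d j) N * M * (iota k (psum d j) (d j) N)ᵀ) h
  simpa only [iota_gmat hN, Matrix.mul_assoc, iota_self hN, Matrix.mul_one] using h1

theorem gyEnt_eq {m : ℕ} {d : ℕ → ℕ} {N : ℕ}
    (g : ∀ j : Fin m, (Matrix (Fin (d (j : ℕ))) (Fin (d (j : ℕ))) k)ˣ) (p c : Fin N) :
    gyEnt g p c = gmat (d := d) N (fun j => (g j).val) p c := by
  rw [gyEnt, gmat, Matrix.sum_apply]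
  apply Finset.sum_congr rfl
  intro j _
  exact dent _ _ _ _ (psum_succ' _ _) (psum_succ' _ _) _ p c _ _

theorem gxEnt_eq {m : ℕ} {d : ℕ → ℕ} {N : ℕ}
    (g : ∀ j : Fin (m + 1), (Matrix (Fin (d (j : ℕ))) (Fin (d (j : ℕ))) k)ˣ) (p c : Fin N) :
    gxEnt g p c = gmat (d := d) N (fun j => (g j).val) p c :=
  gyEnt_eq g p c

theorem gyEnt_zero {m : ℕ} {d : ℕ → ℕ}
    (g : ∀ j : Fin m, (Matrix (Fin (d (j : ℕ))) (Fin (d (j : ℕ))) k)ˣ) (p c t : ℕ)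
    (h : (p < psum d t ∧ psum d t ≤ c) ∨ (c < psum d t ∧ psum d t ≤ p)) :
    gyEnt g p c = 0 := by
  rw [gyEnt]
  apply Finset.sum_eq_zero
  intro j _
  rw [dif_neg]
  rintro ⟨h1, h2, h3, h4⟩
  rcases Nat.lt_or_ge (j : ℕ) t with h5 | h5
  · have := psum_mono' d (Nat.succ_le_of_lt h5)
    simp at this
    omega
  · have := psum_mono' d h5
    omega

theorem gxEnt_zero {m : ℕ} {d : ℕ → ℕ}
    (g : ∀ j : Fin (m + 1), (Matrix (Fin (d (j : ℕ))) (Fin (d (j : ℕ))) k)ˣ) (p c t : ℕ)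
    (h : (p < psum d t ∧ psum d t ≤ c) ∨ (c < psum d t ∧ psum d t ≤ p)) :
    gxEnt g p c = 0 := gyEnt_zero g p c t h

end iotaLemmas

section structured
variable {k : Type} [Field k] {n : ℕ} {dx dy : ℕ → ℕ} {dy0 dy0' : ℕ}

theorem dent' {l l' N N' : ℕ} (s off coff u u' : ℕ) (hu : u = off + l) (hu' : u' = coff + l')
    (M : Matrix (Fin l) (Fin l') k) (p : Fin N) (c : Fin N')
    (h1 : ∀ _ : s + off ≤ s + (p : ℕ) ∧ s + (p : ℕ) < s + u ∧ coff ≤ (c : ℕ) ∧ (c : ℕ) < u',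
      s + (p : ℕ) - (s + off) < l)
    (h2 : ∀ _ : s + off ≤ s + (p : ℕ) ∧ s + (p : ℕ) < s + u ∧ coff ≤ (c : ℕ) ∧ (c : ℕ) < u',
      (c : ℕ) - coff < l') :
    (if h : s + off ≤ s + (p : ℕ) ∧ s + (p : ℕ) < s + u ∧ coff ≤ (c : ℕ) ∧ (c : ℕ) < u' then
      M ⟨s + (p : ℕ) - (s + off), h1 h⟩ ⟨(c : ℕ) - coff, h2 h⟩ else 0) =
    ((iota k off l N)ᵀ * M * iota k coff l' N') p c := by
  subst hu hu'
  rw [mul_iota_apply]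
  split_ifs with h h' h'
  · rw [iota_T_mul_apply, dif_pos ⟨by omega, by omega⟩]
    congr 2
    omega
  · omega
  · rw [iota_T_mul_apply, dif_neg (by omega)]
  · rfl

/-- The `y₀` block row of `A_V`. -/
def A0 (V : QRep k n dx dy dy0 dy0') : Matrix (Fin dy0) (Fin (dXt dx n)) k :=
  V.vb0 * iota k (psum dx 0) (dx 0) (dXt dx n) + V.va1 * iota k (psum dx 1) (dx 1) (dXt dx n)

/-- The `y₀'` block row of `B'_V`. -/
def B0 (V : QRep k n dx dy dy0 dy0') : Matrix (Fin dy0') (Fin (dXt dx n)) k :=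
  V.va1' * iota k (psum dx 1) (dx 1) (dXt dx n)

/-- The common lower block rows of `A_V` and `B'_V`. -/
def A1 (V : QRep k n dx dy dy0 dy0') : Matrix (Fin (dYt dy n)) (Fin (dXt dx n)) k :=
  (∑ i : Fin n, (iota k (psum dy i) (dy i) (dYt dy n))ᵀ * V.vb i * iota k (psum dx (i + 1)) (dx (i + 1)) (dXt dx n)) +
  (∑ i : Fin (n - 1),
    (iota k (psum dy i) (dy i) (dYt dy n))ᵀ * V.va i * iota k (psum dx (i + 2)) (dx (i + 2)) (dXt dx n))

theorem Aent_top (V : QRep k n dx dy dy0 dy0') (p : Fin dy0) (c : Fin (dXt dx n)) :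
    Aent V p c = A0 V p c := by
  rw [Aent, Finset.sum_eq_zero, Finset.sum_eq_zero, add_zero, add_zero, A0, Matrix.add_apply,
    mul_iota_apply, mul_iota_apply]
  · have h0 : psum dx 0 = 0 := rfl
    have h2 : psum dx 2 = psum dx 1 + dx 1 := psum_succ' _ _
    congr 1
    · by_cases h : (c : ℕ) < dx 0
      · rw [dif_pos ⟨p.2, h⟩, dif_pos (by omega)]
        rfl
      · rw [dif_neg (by omega), dif_neg (by omega)]
    · by_cases h : psum dx 1 ≤ (c : ℕ) ∧ (c : ℕ) < psum dx 2
      · rw [dif_pos ⟨p.2, h⟩, dif_pos (by omega)]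
      · rw [dif_neg (by omega), dif_neg (by omega)]
  · intro i _
    rw [dif_neg (by omega)]
  · intro i _
    rw [dif_neg (by omega)]

theorem Bent_top (V : QRep k n dx dy dy0 dy0') (p : Fin dy0') (c : Fin (dXt dx n)) :
    Bent V p c = B0 V p c := by
  rw [Bent, Finset.sum_eq_zero, Finset.sum_eq_zero, add_zero, add_zero, B0,
    mul_iota_apply]
  · have h2 : psum dx 2 = psum dx 1 + dx 1 := psum_succ' _ _
    by_cases h : psum dx 1 ≤ (c : ℕ) ∧ (c : ℕ) < psum dx 2
    · rw [dif_pos ⟨p.2, h⟩, dif_pos (by omega)]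
    · rw [dif_neg (by omega), dif_neg (by omega)]
  · intro i _
    rw [dif_neg (by omega)]
  · intro i _
    rw [dif_neg (by omega)]

theorem Aent_bot (V : QRep k n dx dy dy0 dy0') (p : Fin (dYt dy n)) (c : Fin (dXt dx n)) :
    Aent V (dy0 + p) c = A1 V p c := by
  rw [Aent, dif_neg (by omega), dif_neg (by omega), zero_add, zero_add, A1, Matrix.add_apply,
    Matrix.sum_apply, Matrix.sum_apply]
  congr 1
  · apply Finset.sum_congr rfl
    intro i _
    exact dent' _ _ _ _ _ (psum_succ' _ _) (psum_succ' _ _) _ p c _ _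
  · apply Finset.sum_congr rfl
    intro i _
    exact dent' _ _ _ _ _ (psum_succ' _ _) (psum_succ' _ _) _ p c _ _

theorem Bent_bot (V : QRep k n dx dy dy0 dy0') (p : Fin (dYt dy n)) (c : Fin (dXt dx n)) :
    Bent V (dy0' + p) c = A1 V p c := by
  rw [Bent, dif_neg (by omega), zero_add, A1, Matrix.add_apply,
    Matrix.sum_apply, Matrix.sum_apply]
  congr 1
  · apply Finset.sum_congr rfl
    intro i _
    exact dent' _ _ _ _ _ (psum_succ' _ _) (psum_succ' _ _) _ p c _ _
  · apply Finset.sum_congr rfl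
    intro i _
    exact dent' _ _ _ _ _ (psum_succ' _ _) (psum_succ' _ _) _ p c _ _

/-- The structured index type. -/
abbrev RT (n : ℕ) (dx dy : ℕ → ℕ) (dy0 dy0' : ℕ) : Type :=
  ((Fin dy0 ⊕ Fin (dYt dy n)) ⊕ Fin (dXt dx n)) ⊕ ((Fin dy0' ⊕ Fin (dYt dy n)) ⊕ Fin (dXt dx n))

/-- Row positions. -/
def posR (n : ℕ) (dx dy : ℕ → ℕ) (dy0 dy0' : ℕ) : RT n dx dy dy0 dy0' → ℕ
  | .inl (.inl (.inl r)) => r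
  | .inl (.inl (.inr r)) => dy0 + r
  | .inl (.inr r) => dy0 + dYt dy n + r
  | .inr (.inl (.inl r)) => aD n dx dy dy0 + r
  | .inr (.inl (.inr r)) => aD n dx dy dy0 + dy0' + r
  | .inr (.inr r) => aD n dx dy dy0 + dy0' + dYt dy n + r

/-- Column positions. -/
def posC (n : ℕ) (dx dy : ℕ → ℕ) (dy0 dy0' : ℕ) : RT n dx dy dy0 dy0' → ℕ
  | .inl (.inl (.inl r)) => 2 * dXt dx n + dYt dy n + (dy0 - 1 - r)
  | .inl (.inl (.inr r)) => 2 * dXt dx n + (dYt dy n - 1 - r)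
  | .inl (.inr r) => dXt dx n - 1 - r
  | .inr (.inl (.inl r)) => 2 * dXt dx n + dYt dy n + dy0 + r
  | .inr (.inl (.inr r)) => 2 * dXt dx n + dYt dy n + dy0 + dy0' + r
  | .inr (.inr r) => dXt dx n + r

theorem posR_lt (x : RT n dx dy dy0 dy0') : posR n dx dy dy0 dy0' x < NN n dx dy dy0 dy0' := by
  rcases x with ((r | r) | r) | ((r | r) | r) <;> simp only [posR, NN, aD] <;> omega

theorem posC_lt (x : RT n dx dy dy0 dy0') : posC n dx dy dy0 dy0' x < NN n dx dy dy0 dy0' := by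
  rcases x with ((r | r) | r) | ((r | r) | r) <;> simp only [posC, NN, aD] <;> omega

theorem posR_inj : Function.Injective (posR n dx dy dy0 dy0') := by
  intro x y h
  rcases x with ((r | r) | r) | ((r | r) | r) <;> rcases y with ((s | s) | s) | ((s | s) | s) <;>
    simp only [posR, aD] at h <;>
    first
    | (exfalso; omega)
    | (have : r = s := Fin.ext (by omega)
       rw [this])

theorem posC_inj : Function.Injective (posC n dx dy dy0 dy0') := by
  intro x y h
  rcases x with ((r | r) | r) | ((r | r) | r) <;> rcases y with ((s | s) | s) | ((s | s) | s) <;>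
    simp only [posC] at h <;>
    first
    | (exfalso; omega)
    | (have : r = s := Fin.ext (by omega)
       rw [this])

theorem card_RT : Fintype.card (RT n dx dy dy0 dy0') = Fintype.card (Fin (NN n dx dy dy0 dy0')) := by
  rw [Fintype.card_fin]
  simp only [Fintype.card_sum, Fintype.card_fin, NN, aD]

/-- Row equivalence. -/
noncomputable def eR (n : ℕ) (dx dy : ℕ → ℕ) (dy0 dy0' : ℕ) :
    RT n dx dy dy0 dy0' ≃ Fin (NN n dx dy dy0 dy0') :=
  Equiv.ofBijective (fun x => ⟨posR n dx dy dy0 dy0' x, posR_lt x⟩)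
    ((Fintype.bijective_iff_injective_and_card _).2
      ⟨fun _ _ h => posR_inj (Fin.mk.inj_iff.1 h), card_RT⟩)

/-- Column equivalence. -/
noncomputable def eC (n : ℕ) (dx dy : ℕ → ℕ) (dy0 dy0' : ℕ) :
    RT n dx dy dy0 dy0' ≃ Fin (NN n dx dy dy0 dy0') :=
  Equiv.ofBijective (fun x => ⟨posC n dx dy dy0 dy0' x, posC_lt x⟩)
    ((Fintype.bijective_iff_injective_and_card _).2
      ⟨fun _ _ h => posC_inj (Fin.mk.inj_iff.1 h), card_RT⟩)

theorem eR_val (x : RT n dx dy dy0 dy0') :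
    ((eR n dx dy dy0 dy0' x : Fin _) : ℕ) = posR n dx dy dy0 dy0' x := rfl

theorem eC_val (x : RT n dx dy dy0 dy0') :
    ((eC n dx dy dy0 dy0' x : Fin _) : ℕ) = posC n dx dy dy0 dy0' x := rfl

/-- Structured form of `η`. -/
def etaT (V : QRep k n dx dy dy0 dy0') :
    Matrix (RT n dx dy dy0 dy0') (RT n dx dy dy0 dy0') k :=
  fromBlocks 1 (fromBlocks 0 (fromRows (A0 V) (A1 V)) 0 0)
    (fromBlocks (fromBlocks 0 0 0 1) 0 0 1) (fromBlocks 1 (fromRows (B0 V) (A1 V)) 0 1)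

/-- The `g_x` block. -/
def gX (g : GLd k n dx dy dy0 dy0') : Matrix (Fin (dXt dx n)) (Fin (dXt dx n)) k :=
  gmat (d := dx) _ (fun j => (g.2.2.1 j).val)

/-- The `g_y` block. -/
def gY (g : GLd k n dx dy dy0 dy0') : Matrix (Fin (dYt dy n)) (Fin (dYt dy n)) k :=
  gmat (d := dy) _ (fun j => (g.2.2.2 j).val)

/-- Structured form of `θ`. -/
def thT (g : GLd k n dx dy dy0 dy0') :
    Matrix (RT n dx dy dy0 dy0') (RT n dx dy dy0 dy0') k :=
  fromBlocks (fromBlocks (fromBlocks g.1.val 0 0 (gY g)) 0 0 (gX g)) 0 0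
    (fromBlocks (fromBlocks g.2.1.val 0 0 (gY g)) 0 0 (gX g))

theorem gX_mul (g g' : GLd k n dx dy dy0 dy0') : gX (g * g') = gX g * gX g' :=
  gmat_mul le_rfl _ _

theorem gY_mul (g g' : GLd k n dx dy dy0 dy0') : gY (g * g') = gY g * gY g' :=
  gmat_mul le_rfl _ _

theorem gX_one : gX (1 : GLd k n dx dy dy0 dy0') = 1 := gmat_one rfl

theorem gY_one : gY (1 : GLd k n dx dy dy0 dy0') = 1 := gmat_one rfl

theorem thT_mul (g g' : GLd k n dx dy dy0 dy0') : thT (g * g') = thT g * thT g' := by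
  have h1 : (g * g').1.val = g.1.val * g'.1.val := rfl
  have h2 : (g * g').2.1.val = g.2.1.val * g'.2.1.val := rfl
  simp [thT, fromBlocks_multiply, gX_mul, gY_mul, h1, h2]

theorem thT_one : thT (1 : GLd k n dx dy dy0 dy0') = 1 := by
  have h1 : (1 : GLd k n dx dy dy0 dy0').1.val = 1 := rfl
  have h2 : (1 : GLd k n dx dy dy0 dy0').2.1.val = 1 := rfl
  simp [thT, gX_one, gY_one, h1, h2]

theorem thT_inv_mul (g : GLd k n dx dy dy0 dy0') : thT g⁻¹ * thT g = 1 := by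
  rw [← thT_mul, inv_mul_cancel, thT_one]

theorem thT_isUnit (g : GLd k n dx dy dy0 dy0') : IsUnit (thT g) :=
  (Matrix.isUnit_iff_isUnit_det _).2 (Matrix.isUnit_det_of_left_inverse (thT_inv_mul g))

theorem thT_inj (g g' : GLd k n dx dy dy0 dy0') (h : thT g = thT g') : g = g' := by
  simp only [thT, fromBlocks_inj, true_and] at h
  obtain ⟨⟨⟨h1, h2⟩, h3⟩, ⟨h4, -⟩, -⟩ := h
  have h3' := gmat_inj le_rfl _ _ h3
  have h2' := gmat_inj le_rfl _ _ h2
  refine Prod.ext (Units.ext h1) (Prod.ext (Units.ext h4) (Prod.ext ?_ ?_))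
  · funext j
    exact Units.ext (congrFun h3' j)
  · funext j
    exact Units.ext (congrFun h2' j)

theorem etaT_isUnit (V : QRep k n dx dy dy0 dy0') : IsUnit (etaT V) := by
  rw [Matrix.isUnit_iff_isUnit_det, etaT, det_fromBlocks_one₁₁]
  simp [fromBlocks_multiply, sub_eq_add_neg, fromBlocks_neg, fromBlocks_add]

theorem iota_gX (g : GLd k n dx dy dy0 dy0') (j : ℕ) (hj : j < n + 1)
    (u : Matrix (Fin (dx j)) (Fin (dx j)) k) (hu : u = (g.2.2.1 ⟨j, hj⟩).val) :
    iota k (psum dx j) (dx j) (dXt dx n) * gX g = u * iota k (psum dx j) (dx j) (dXt dx n) :=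
  hu ▸ iota_gmat (d := dx) le_rfl (fun j => (g.2.2.1 j).val) ⟨j, hj⟩

theorem gY_iotaT (g : GLd k n dx dy dy0 dy0') (j : ℕ) (hj : j < n)
    (u : Matrix (Fin (dy j)) (Fin (dy j)) k) (hu : u = (g.2.2.2 ⟨j, hj⟩).val) :
    gY g * (iota k (psum dy j) (dy j) (dYt dy n))ᵀ = (iota k (psum dy j) (dy j) (dYt dy n))ᵀ * u :=
  hu ▸ gmat_iotaT (d := dy) le_rfl (fun j => (g.2.2.2 j).val) ⟨j, hj⟩

theorem unit_cancel {l l' l'' : ℕ} (u : (Matrix (Fin l) (Fin l) k)ˣ) (M : Matrix (Fin l) (Fin l') k)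
    (v : Matrix (Fin l') (Fin l'') k) : u.val * ((u⁻¹).val * M * v) = M * v := by
  rw [← Matrix.mul_assoc, ← Matrix.mul_assoc, Units.mul_inv, Matrix.one_mul]

theorem A0_act (hn : 1 ≤ n) (V : QRep k n dx dy dy0 dy0') (g : GLd k n dx dy dy0 dy0') :
    g.1.val * A0 (repAct hn V g) = A0 V * gX g := by
  simp only [A0, repAct, Matrix.mul_add, Matrix.add_mul]
  rw [← Matrix.mul_assoc, unit_cancel, ← Matrix.mul_assoc, unit_cancel,
    Matrix.mul_assoc V.vb0 (iota _ _ _ _), iota_gX g 0 (by omega) _ rfl,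
    Matrix.mul_assoc V.va1 (iota _ _ _ _), iota_gX g 1 (by omega) _ rfl]
  simp only [Matrix.mul_assoc]

theorem B0_act (hn : 1 ≤ n) (V : QRep k n dx dy dy0 dy0') (g : GLd k n dx dy dy0 dy0') :
    g.2.1.val * B0 (repAct hn V g) = B0 V * gX g := by
  simp only [B0, repAct]
  rw [← Matrix.mul_assoc, unit_cancel,
    Matrix.mul_assoc V.va1' (iota _ _ _ _), iota_gX g 1 (by omega) _ rfl]
  simp only [Matrix.mul_assoc]

theorem A1_act (hn : 1 ≤ n) (V : QRep k n dx dy dy0 dy0') (g : GLd k n dx dy dy0 dy0') :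
    gY g * A1 (repAct hn V g) = A1 V * gX g := by
  simp only [A1, repAct, Matrix.mul_add, Matrix.add_mul, Matrix.mul_sum, Matrix.sum_mul]
  congr 1
  · apply Finset.sum_congr rfl
    intro i _
    rw [Matrix.mul_assoc _ (iota _ _ _ _) (gX g), iota_gX g (i + 1) (by omega) _ rfl,
      ← Matrix.mul_assoc, ← Matrix.mul_assoc, gY_iotaT g i i.2 _ rfl, Matrix.mul_assoc _ᵀ _ _,
      unit_cancel]
    simp only [Matrix.mul_assoc]
  · apply Finset.sum_congr rfl
    intro i _
    rw [Matrix.mul_assoc _ (iota _ _ _ _) (gX g), iota_gX g (i + 2) (by omega) _ rfl,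
      ← Matrix.mul_assoc, ← Matrix.mul_assoc, gY_iotaT g i (by omega) _ rfl, Matrix.mul_assoc _ᵀ _ _,
      unit_cancel]
    simp only [Matrix.mul_assoc]

theorem etaT_act (hn : 1 ≤ n) (V : QRep k n dx dy dy0 dy0') (g : GLd k n dx dy dy0 dy0') :
    thT g * etaT (repAct hn V g) = etaT V * thT g := by
  simp [thT, etaT, fromBlocks_multiply, fromBlocks_mul_fromRows, fromRows_mul, A0_act, B0_act,
    A1_act]

theorem etaT_act' (hn : 1 ≤ n) (V : QRep k n dx dy dy0 dy0') (g : GLd k n dx dy dy0 dy0') :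
    etaT (repAct hn V g) = thT g⁻¹ * (etaT V * thT g) := by
  rw [← etaT_act hn, ← Matrix.mul_assoc, thT_inv_mul, Matrix.one_mul]


theorem mat_congr {l l' : ℕ} (M : Matrix (Fin l) (Fin l') k) {a b : Fin l} {c d : Fin l'}
    (h : (a : ℕ) = b) (h' : (c : ℕ) = d) : M a c = M b d := by
  rw [Fin.ext h, Fin.ext h']

set_option maxHeartbeats 4000000 in
theorem eta_sub (V : QRep k n dx dy dy0 dy0') :
    (etaMat V).submatrix (eR n dx dy dy0 dy0') (eC n dx dy dy0 dy0') = etaT V := by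
  ext x y
  have hi := eR_val x
  have hc := eC_val y
  rw [Matrix.submatrix_apply]
  generalize eR n dx dy dy0 dy0' x = i at *
  generalize eC n dx dy dy0 dy0' y = c at *
  have ha : aD n dx dy dy0 = dy0 + dYt dy n + dXt dx n := rfl
  rw [etaMat, Matrix.of_apply]
  rcases x with ((r | r) | r) | ((r | r) | r) <;> rcases y with ((s | s) | s) | ((s | s) | s) <;>
    simp only [posR, posC] at hi hc <;>
    simp only [etaT, fromBlocks_apply₁₁, fromBlocks_apply₁₂, fromBlocks_apply₂₁,
      fromBlocks_apply₂₂, fromRows_apply_inl, fromRows_apply_inr, Matrix.zero_apply,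
      Matrix.one_apply, Sum.inl.injEq, Sum.inr.injEq, reduceCtorEq, if_false]
  all_goals
    have hr := r.2
    have hs := s.2
    first
    | (rw [if_pos (by omega), hi, hc, Nat.add_sub_cancel_left]
       first
       | exact Aent_top V r s
       | exact Aent_bot V r s)
    | (rw [if_neg (by omega), if_pos (by omega), hi, hc, Nat.add_sub_cancel_left,
         Nat.add_sub_cancel_left]
       exact Bent_top V r s)
    | (rw [if_neg (by omega), if_pos (by omega), hi, hc, Nat.add_assoc _ dy0',
         Nat.add_sub_cancel_left, Nat.add_sub_cancel_left]
       exact Bent_bot V r s)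
    | rw [if_neg (by omega), if_neg (by omega)]
  all_goals
    generalize (i : ℕ) = i at *
    generalize (c : ℕ) = c at *
    try simp only [Fin.ext_iff]
    generalize (r : ℕ) = r at *
    generalize (s : ℕ) = s at *
    generalize dXt dx n = X at *
    generalize dYt dy n = Y at *
    generalize aD n dx dy dy0 = a at *
    subst ha hi hc
    first
    | (refine if_neg ?_
       rintro (⟨⟨_, _⟩, ⟨_, _⟩, _⟩ | ⟨⟨_, _⟩, ⟨_, _⟩, _⟩ | ⟨⟨_, _⟩, ⟨_, _⟩, _⟩ |
         ⟨⟨_, _⟩, ⟨_, _⟩, _⟩ | ⟨⟨_, _⟩, ⟨_, _⟩, _⟩ | ⟨⟨_, _⟩, ⟨_, _⟩, _⟩ |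
         ⟨⟨_, _⟩, ⟨_, _⟩, _⟩ | ⟨⟨_, _⟩, ⟨_, _⟩, _⟩) <;> omega)
    | (refine if_congr ⟨?_, ?_⟩ rfl rfl
       · rintro (⟨⟨_, _⟩, ⟨_, _⟩, _⟩ | ⟨⟨_, _⟩, ⟨_, _⟩, _⟩ | ⟨⟨_, _⟩, ⟨_, _⟩, _⟩ |
           ⟨⟨_, _⟩, ⟨_, _⟩, _⟩ | ⟨⟨_, _⟩, ⟨_, _⟩, _⟩ | ⟨⟨_, _⟩, ⟨_, _⟩, _⟩ |
           ⟨⟨_, _⟩, ⟨_, _⟩, _⟩ | ⟨⟨_, _⟩, ⟨_, _⟩, _⟩) <;> omega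
       · rintro rfl
         first
         | exact Or.inl (by omega)
         | exact Or.inr (Or.inl (by omega))
         | exact Or.inr (Or.inr (Or.inl (by omega)))
         | exact Or.inr (Or.inr (Or.inr (Or.inl (by omega))))
         | exact Or.inr (Or.inr (Or.inr (Or.inr (Or.inl (by omega)))))
         | exact Or.inr (Or.inr (Or.inr (Or.inr (Or.inr (Or.inl (by omega))))))
         | exact Or.inr (Or.inr (Or.inr (Or.inr (Or.inr (Or.inr (Or.inl (by omega)))))))
         | exact Or.inr (Or.inr (Or.inr (Or.inr (Or.inr (Or.inr (Or.inr (by omega))))))))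

theorem gx_eq' (g : GLd k n dx dy dy0 dy0') (r s : Fin (dXt dx n)) :
    gxEnt g.2.2.1 r s = gX g r s := gxEnt_eq _ _ _

theorem gy_eq' (g : GLd k n dx dy dy0 dy0') (r s : Fin (dYt dy n)) :
    gyEnt g.2.2.2 r s = gY g r s := gyEnt_eq _ _ _

theorem theta_sub (g : GLd k n dx dy dy0 dy0') :
    (thetaMat g).submatrix (eC n dx dy dy0 dy0') (eC n dx dy dy0 dy0') = thT g := by
  ext x y
  have hi := eC_val x
  have hc := eC_val y
  rw [Matrix.submatrix_apply]
  generalize eC n dx dy dy0 dy0' x = i at *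
  generalize eC n dx dy dy0 dy0' y = c at *
  rw [thetaMat, Matrix.of_apply]
  rcases x with ((r | r) | r) | ((r | r) | r) <;> rcases y with ((s | s) | s) | ((s | s) | s) <;>
    simp only [posC] at hi hc <;>
    simp only [thT, fromBlocks_apply₁₁, fromBlocks_apply₁₂, fromBlocks_apply₂₁,
      fromBlocks_apply₂₂, Matrix.zero_apply]
  all_goals
    first
    | (rw [if_neg (by omega), if_neg (by omega), if_neg (by omega), dif_neg (by omega),
        dif_neg (by omega), if_neg (by omega)])
    | (rw [if_pos (by omega), ← gx_eq' g r s]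
       congr 1 <;> omega)
    | (rw [if_neg (by omega), if_pos (by omega), ← gx_eq' g r s]
       congr 1 <;> omega)
    | (rw [if_neg (by omega), if_neg (by omega), if_pos (by omega), ← gy_eq' g r s]
       congr 1 <;> omega)
    | (rw [if_neg (by omega), if_neg (by omega), if_neg (by omega), dif_pos (by omega)]
       refine mat_congr _ ?_ ?_ <;> dsimp only <;> omega)
    | (rw [if_neg (by omega), if_neg (by omega), if_neg (by omega), dif_neg (by omega),
         dif_pos (by omega)]
       refine mat_congr _ ?_ ?_ <;> dsimp only <;> omega)
    | (rw [if_neg (by omega), if_neg (by omega), if_neg (by omega), dif_neg (by omega),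
         dif_neg (by omega), if_pos (by omega), ← gy_eq' g r s]
       congr 1 <;> omega)

theorem eta_eq (V : QRep k n dx dy dy0 dy0') :
    etaMat V = (etaT V).submatrix (eR n dx dy dy0 dy0').symm (eC n dx dy dy0 dy0').symm := by
  rw [← eta_sub]
  simp

theorem theta_eq (g : GLd k n dx dy dy0 dy0') :
    thetaMat g = (thT g).submatrix (eC n dx dy dy0 dy0').symm (eC n dx dy dy0 dy0').symm := by
  rw [← theta_sub]
  simp

theorem kappa_mem (g : GLd k n dx dy dy0 dy0') :
    (thT g).submatrix (eR n dx dy dy0 dy0').symm (eR n dx dy dy0 dy0').symm ∈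
      kDiag k n dx dy dy0 dy0' := by
  refine ⟨(Matrix.isUnit_submatrix_equiv _ _).2 (thT_isUnit g), ?_⟩
  intro i c
  obtain ⟨x, rfl⟩ := (eR n dx dy dy0 dy0').surjective i
  obtain ⟨y, rfl⟩ := (eR n dx dy dy0 dy0').surjective c
  simp only [Matrix.submatrix_apply, Equiv.symm_apply_apply, eR_val]
  have key : ∀ z, posR n dx dy dy0 dy0' (.inl z) < aD n dx dy dy0 := by
    rintro ((r | r) | r) <;> simp only [posR, aD] <;> omega
  have key' : ∀ z, aD n dx dy dy0 ≤ posR n dx dy dy0 dy0' (.inr z) := by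
    rintro ((r | r) | r) <;> simp only [posR, aD] <;> omega
  intro h
  rcases x with x | x <;> rcases y with y | y
  · have := key x
    have := key y
    omega
  · rfl
  · rfl
  · have := key' x
    have := key' y
    omega

theorem theta_para (g : GLd k n dx dy dy0 dy0') : thetaMat g ∈ pPara k n dx dy dy0 dy0' := by
  refine ⟨?_, ?_⟩
  · rw [theta_eq]
    exact (Matrix.isUnit_submatrix_equiv _ _).2 (thT_isUnit g)
  · rintro i c ⟨x, hx, hc, hi⟩
    have hX : ∀ m, m ≤ n + 1 → psum dx m ≤ dXt dx n := fun m hm => psum_mono' dx hm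
    have hY : ∀ m, m ≤ n → psum dy m ≤ dYt dy n := fun m hm => psum_mono' dy hm
    have hiN : (i : ℕ) < 2 * dXt dx n + dYt dy n + dy0 + dy0' + dYt dy n := by
      have := i.2
      simp only [NN, aD] at this
      omega
    simp only [thetaMat, Matrix.of_apply]
    split_ifs with h1 h2 h3 h4 h5 h6
    · rcases hx with ⟨m, hm, rfl⟩ | ⟨m, hm, rfl⟩ | ⟨m, hm, rfl⟩ | rfl | ⟨m, hm, rfl⟩
      · have := hX m hm
        exact gxEnt_zero _ _ _ m (by omega)
      · omega
      · have := hY m hm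
        omega
      · omega
      · omega
    · rcases hx with ⟨m, hm, rfl⟩ | ⟨m, hm, rfl⟩ | ⟨m, hm, rfl⟩ | rfl | ⟨m, hm, rfl⟩
      · omega
      · have := hX m hm
        exact gxEnt_zero _ _ _ m (by omega)
      · have := hY m hm
        omega
      · omega
      · omega
    · rcases hx with ⟨m, hm, rfl⟩ | ⟨m, hm, rfl⟩ | ⟨m, hm, rfl⟩ | rfl | ⟨m, hm, rfl⟩
      · omega
      · have := hX m hm
        omega
      · have := hY m hm
        exact gyEnt_zero _ _ _ m (by omega)
      · omega
      · omega
    · exfalso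
      rcases hx with ⟨m, hm, rfl⟩ | ⟨m, hm, rfl⟩ | ⟨m, hm, rfl⟩ | rfl | ⟨m, hm, rfl⟩
      · omega
      · have := hX m hm
        omega
      · omega
      · omega
      · omega
    · exfalso
      rcases hx with ⟨m, hm, rfl⟩ | ⟨m, hm, rfl⟩ | ⟨m, hm, rfl⟩ | rfl | ⟨m, hm, rfl⟩
      · omega
      · have := hX m hm
        omega
      · omega
      · omega
      · omega
    · rcases hx with ⟨m, hm, rfl⟩ | ⟨m, hm, rfl⟩ | ⟨m, hm, rfl⟩ | rfl | ⟨m, hm, rfl⟩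
      · omega
      · have := hX m hm
        omega
      · omega
      · omega
      · exact gyEnt_zero _ _ _ m (by omega)
    · rfl

end structured

/-- Every `η(V)` is invertible; `θ` is an injective group homomorphism
with image contained in the parabolic subgroup `P(d*)`; and `η` is equivariant with
respect to `θ`: for every `V` and `g` there exists `κ ∈ K` with
`η(V·g) = κ·η(V)·θ(g)`. -/
theorem stmt12 (k : Type) [Field k] (n : ℕ) (hn : 1 ≤ n) (dx dy : ℕ → ℕ)
    (dy0 dy0' : ℕ) :
    (∀ V : QRep k n dx dy dy0 dy0', IsUnit (etaMat V)) ∧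
    Function.Injective (thetaMat (k := k) (n := n) (dx := dx) (dy := dy)
      (dy0 := dy0) (dy0' := dy0')) ∧
    (∀ g g' : GLd k n dx dy dy0 dy0', thetaMat (g * g') = thetaMat g * thetaMat g') ∧
    (∀ g : GLd k n dx dy dy0 dy0', thetaMat g ∈ pPara k n dx dy dy0 dy0') ∧
    (∀ (V : QRep k n dx dy dy0 dy0') (g : GLd k n dx dy dy0 dy0'),
      ∃ κ ∈ kDiag k n dx dy dy0 dy0',
        etaMat (repAct hn V g) = κ * (etaMat V * thetaMat g)) := by
  refine ⟨fun V => ?_, fun g g' h => ?_, fun g g' => ?_, theta_para, fun V g => ?_⟩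
  · rw [eta_eq]
    exact (Matrix.isUnit_submatrix_equiv _ _).2 (etaT_isUnit V)
  · apply thT_inj
    rw [← theta_sub, ← theta_sub, h]
  · rw [theta_eq, theta_eq g, theta_eq g', Matrix.submatrix_mul_equiv, thT_mul]
  · refine ⟨_, kappa_mem g⁻¹, ?_⟩
    rw [eta_eq, eta_eq V, theta_eq g, Matrix.submatrix_mul_equiv, Matrix.submatrix_mul_equiv,
      etaT_act']
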